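/- arXiv:2211.10323 — 7 statements merged into one kernel-verified Lean document; each statement's English description precedes it below -/
import Mathlib

section
/- If S ⊆ ℝ³ is compact, then the set { p / Q(p) : p ∈ S \ LC } is closed in ℝ³; consequently the Möbius inversion i_M(S), defined as the topological closure of this set, equals the set itself. -/
noncomputable section

/-- The Minkowski bilinear form on `ℝ³`. -/
def B (p q : EuclideanSpace ℝ (Fin 3)) : ℝ := p 0 * q 0 + p 1 * q 1 - p 2 * q 2

/-- The Minkowski quadratic form. -/
def Q (p : EuclideanSpace ℝ (Fin 3)) : ℝ := B p p

/-- The light cone. -/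
def LC : Set (EuclideanSpace ℝ (Fin 3)) := {p | Q p = 0}

/-- The Möbius inversion `i_M(p) = p / Q(p)`. -/
def iM (p : EuclideanSpace ℝ (Fin 3)) : EuclideanSpace ℝ (Fin 3) := (Q p)⁻¹ • p

theorem continuous_Q : Continuous Q := by
  unfold Q B
  fun_prop

theorem Q_smul (c : ℝ) (p : EuclideanSpace ℝ (Fin 3)) : Q (c • p) = c ^ 2 * Q p := by
  simp only [Q, B, PiLp.smul_apply, smul_eq_mul]
  ring

theorem Q_mul_Q_iM {p : EuclideanSpace ℝ (Fin 3)} (hp : Q p ≠ 0) : Q p * Q (iM p) = 1 := by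
  rw [iM, Q_smul]
  field_simp

theorem Q_smul_iM {p : EuclideanSpace ℝ (Fin 3)} (hp : Q p ≠ 0) : Q p • iM p = p :=
  smul_inv_smul₀ hp p

/-- The inversion of a set is the projection of a set cut out by closed conditions. -/
theorem image_iM_diff_LC (S : Set (EuclideanSpace ℝ (Fin 3))) :
    iM '' (S \ LC) = {q | ∃ p ∈ S, Q p * Q q = 1 ∧ Q p • q = p} := by
  ext q
  constructor
  · rintro ⟨p, ⟨hpS, hp⟩, rfl⟩
    exact ⟨p, hpS, Q_mul_Q_iM hp, Q_smul_iM hp⟩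
  · rintro ⟨p, hpS, hQ, hpq⟩
    have hp : Q p ≠ 0 := left_ne_zero_of_mul_eq_one hQ
    exact ⟨p, ⟨hpS, hp⟩, (inv_smul_eq_iff₀ hp).2 hpq.symm⟩

theorem isClosed_image_iM_diff_LC {S : Set (EuclideanSpace ℝ (Fin 3))} (hS : IsCompact S) :
    IsClosed (iM '' (S \ LC)) := by
  rw [image_iM_diff_LC]
  refine isClosed_of_closure_subset fun q hq => ?_
  obtain ⟨u, hu, hlim⟩ := mem_closure_iff_seq_limit.1 hq
  choose p hpS hQ hpq using hu
  obtain ⟨a, haS, φ, hφ, ha⟩ := hS.tendsto_subseq hpS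
  have hu' := hlim.comp hφ.tendsto_atTop
  have hQa := (continuous_Q.tendsto a).comp ha
  have hQq := (continuous_Q.tendsto q).comp hu'
  refine ⟨a, haS, tendsto_nhds_unique (hQa.mul hQq) ?_, tendsto_nhds_unique (hQa.smul hu') ?_⟩
  · simp [hQ]
  · simpa [hpq, Function.comp_def] using ha

theorem stmt_3 (S : Set (EuclideanSpace ℝ (Fin 3))) (hS : IsCompact S) :
    IsClosed (iM '' (S \ LC)) ∧ closure (iM '' (S \ LC)) = iM '' (S \ LC) := by
  exact ⟨isClosed_image_iM_diff_LC hS, (isClosed_image_iM_diff_LC hS).closure_eq⟩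
end
end

section
/- If S ⊆ ℝ³ is compact, then the topological closure of { p / Q(p) : p ∈ S \ LC } does not intersect the light cone LC. -/
noncomputable section

theorem Q_iM (p : EuclideanSpace ℝ (Fin 3)) : Q (iM p) = (Q p)⁻¹ := by
  have h (c : ℝ) : Q (c • p) = c ^ 2 * Q p := by
    simp only [Q, B, PiLp.smul_apply, smul_eq_mul]
    ring
  rw [iM, h]
  by_cases hp : Q p = 0
  · simp [hp]
  · field_simp

theorem stmt_4 (S : Set (EuclideanSpace ℝ (Fin 3))) (hS : IsCompact S) :
    closure (iM '' (S \ LC)) ∩ LC = ∅ := by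
  obtain ⟨M, hM⟩ := hS.exists_bound_of_continuousOn continuous_Q.continuousOn
  have hsub : closure (iM '' (S \ LC)) ⊆ {q | 1 ≤ M * |Q q|} := by
    refine closure_minimal ?_
      (isClosed_le continuous_const (continuous_const.mul continuous_Q.abs))
    rintro _ ⟨p, ⟨hpS, hp⟩, rfl⟩
    have hpos : 0 < |Q p| := abs_pos.mpr hp
    rw [Set.mem_ofPred_eq, Q_iM, abs_inv, ← div_eq_mul_inv, one_le_div hpos]
    exact hM p hpS
  refine Set.eq_empty_of_forall_notMem ?_
  rintro q ⟨hq, hq0 : Q q = 0⟩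
  have h : 1 ≤ M * |Q q| := hsub hq
  norm_num [hq0] at h
end
end

section
/- The Möbius inversion i_M is conformal with respect to the Minkowski metric: for every p ∈ ℝ³ with Q(p) ≠ 0 and all vectors v, w ∈ ℝ³, one has B(Di_M(p)(v), Di_M(p)(w)) = B(v, w) / Q(p)², where Di_M(p) denotes the (Fréchet) derivative of i_M at p. -/
noncomputable section

theorem hasFDerivAt_Q (p : EuclideanSpace ℝ (Fin 3)) :
    ∃ L : EuclideanSpace ℝ (Fin 3) →L[ℝ] ℝ, HasFDerivAt Q L p ∧ ∀ v, L v = 2 * B p v := by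
  have h (i : Fin 3) := (EuclideanSpace.proj i : EuclideanSpace ℝ (Fin 3) →L[ℝ] ℝ).hasFDerivAt
    (x := p)
  refine ⟨_, (((h 0).mul (h 0)).add ((h 1).mul (h 1))).sub ((h 2).mul (h 2)), fun v => ?_⟩
  simp [B]
  ring

theorem fderiv_iM_apply (p : EuclideanSpace ℝ (Fin 3)) (hp : Q p ≠ 0)
    (v : EuclideanSpace ℝ (Fin 3)) :
    fderiv ℝ iM p v = (Q p)⁻¹ • v - (2 * B p v / Q p ^ 2) • p := by
  obtain ⟨L, hL, hLv⟩ := hasFDerivAt_Q p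
  have h : HasFDerivAt iM _ p :=
    ((hasDerivAt_inv hp).comp_hasFDerivAt p hL).smul (hasFDerivAt_id p)
  rw [h.fderiv]
  ext i
  simp [hLv]
  ring

theorem stmt_6 (p : EuclideanSpace ℝ (Fin 3)) (hp : Q p ≠ 0)
    (v w : EuclideanSpace ℝ (Fin 3)) :
    B (fderiv ℝ iM p v) (fderiv ℝ iM p w) = B v w / Q p ^ 2 := by
  rw [fderiv_iM_apply p hp, fderiv_iM_apply p hp]
  have hQ : Q p = p 0 * p 0 + p 1 * p 1 - p 2 * p 2 := rfl
  have expand (a b a' c : ℝ) : B (a • v - b • p) (a' • w - c • p) =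
      a * a' * B v w - a * c * B p v - b * a' * B p w + b * c * Q p := by
    simp only [hQ, B, PiLp.sub_apply, PiLp.smul_apply, smul_eq_mul]
    ring
  rw [expand]
  field_simp
  ring
end
end

section
/- Let U ⊆ ℝ² be open and φ : U → ℝ³ a smooth map with Q(φ(u,v)) ≠ 0 for all (u,v) ∈ U, and set ψ = i_M ∘ φ, i.e. ψ(u,v) = φ(u,v)/Q(φ(u,v)). Then the first fundamental form coefficients transform by B(ψ_u, ψ_u) = B(φ_u, φ_u)/Q(φ)², B(ψ_u, ψ_v) = B(φ_u, φ_v)/Q(φ)², and B(ψ_v, ψ_v) = B(φ_v, φ_v)/Q(φ)², where subscripts u, v denote partial derivatives. -/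
noncomputable section

/-- Partial derivative with respect to the first variable. -/
def pdu (χ : ℝ × ℝ → EuclideanSpace ℝ (Fin 3)) (x : ℝ × ℝ) : EuclideanSpace ℝ (Fin 3) :=
  fderiv ℝ χ x (1, 0)

/-- Partial derivative with respect to the second variable. -/
def pdv (χ : ℝ × ℝ → EuclideanSpace ℝ (Fin 3)) (x : ℝ × ℝ) : EuclideanSpace ℝ (Fin 3) :=
  fderiv ℝ χ x (0, 1)

/-- The differential of the inversion `iM` at `p`, applied to `v`. -/
def iMDeriv (p v : EuclideanSpace ℝ (Fin 3)) : EuclideanSpace ℝ (Fin 3) :=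
  (Q p)⁻¹ • v - (2 * B p v / Q p ^ 2) • p

/-- The differential of the inversion is conformal with factor `1 / Q p ^ 2`. -/
theorem B_iMDeriv {p : EuclideanSpace ℝ (Fin 3)} (hp : Q p ≠ 0)
    (v w : EuclideanSpace ℝ (Fin 3)) :
    B (iMDeriv p v) (iMDeriv p w) = B v w / Q p ^ 2 := by
  have expand : B (iMDeriv p v) (iMDeriv p w) =
      (Q p)⁻¹ ^ 2 * B v w - (Q p)⁻¹ * (2 * B p w / Q p ^ 2) * B p v
        - (Q p)⁻¹ * (2 * B p v / Q p ^ 2) * B p w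
        + (2 * B p v / Q p ^ 2) * (2 * B p w / Q p ^ 2) * Q p := by
    unfold iMDeriv
    generalize 2 * B p v / Q p ^ 2 = a
    generalize 2 * B p w / Q p ^ 2 = b
    generalize (Q p)⁻¹ = c
    simp only [Q, B, PiLp.sub_apply, PiLp.smul_apply, smul_eq_mul]
    ring
  rw [expand]
  field_simp
  ring

theorem fderiv_Q_comp {E : Type*} [NormedAddCommGroup E] [NormedSpace ℝ E]
    {φ : E → EuclideanSpace ℝ (Fin 3)} {x : E} (hφ : DifferentiableAt ℝ φ x) :
    DifferentiableAt ℝ (fun y => Q (φ y)) x ∧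
      ∀ h, fderiv ℝ (fun y => Q (φ y)) x h = 2 * B (φ x) (fderiv ℝ φ x h) := by
  have coord (i : Fin 3) : HasFDerivAt (fun y => φ y i)
      ((EuclideanSpace.proj i).comp (fderiv ℝ φ x)) x :=
    (EuclideanSpace.proj (𝕜 := ℝ) i).hasFDerivAt.comp x hφ.hasFDerivAt
  have key := (((coord 0).mul (coord 0)).add ((coord 1).mul (coord 1))).sub
    ((coord 2).mul (coord 2))
  replace key : HasFDerivAt (fun y => Q (φ y)) _ x := key
  refine ⟨key.differentiableAt, fun h => ?_⟩
  rw [key.fderiv]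
  simp [B]
  ring

theorem fderiv_iM_comp {E : Type*} [NormedAddCommGroup E] [NormedSpace ℝ E]
    {φ : E → EuclideanSpace ℝ (Fin 3)} {x : E} (hφ : DifferentiableAt ℝ φ x)
    (hQ : Q (φ x) ≠ 0) (h : E) :
    fderiv ℝ (fun y => iM (φ y)) x h = iMDeriv (φ x) (fderiv ℝ φ x h) := by
  obtain ⟨hd, hderiv⟩ := fderiv_Q_comp hφ
  have hinv := (hasDerivAt_inv hQ).comp_hasFDerivAt x hd.hasFDerivAt
  have key : HasFDerivAt (fun y => iM (φ y)) _ x := hinv.smul hφ.hasFDerivAt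
  rw [key.fderiv]
  simp only [iMDeriv, Function.comp_apply, add_apply,
    smul_apply, ContinuousLinearMap.smulRight_apply, hderiv, smul_eq_mul]
  rw [sub_eq_add_neg, ← neg_smul]
  congr 2
  ring

theorem stmt_7 (U : Set (ℝ × ℝ)) (hU : IsOpen U)
    (φ ψ : ℝ × ℝ → EuclideanSpace ℝ (Fin 3))
    (hφ : ContDiffOn ℝ (⊤ : ℕ∞) φ U) (hQ : ∀ x ∈ U, Q (φ x) ≠ 0)
    (hψ : ∀ x, ψ x = iM (φ x)) (x : ℝ × ℝ) (hx : x ∈ U) :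
    B (pdu ψ x) (pdu ψ x) = B (pdu φ x) (pdu φ x) / Q (φ x) ^ 2 ∧
    B (pdu ψ x) (pdv ψ x) = B (pdu φ x) (pdv φ x) / Q (φ x) ^ 2 ∧
    B (pdv ψ x) (pdv ψ x) = B (pdv φ x) (pdv φ x) / Q (φ x) ^ 2 := by
  have hd : DifferentiableAt ℝ φ x :=
    (hφ.contDiffAt (hU.mem_nhds hx)).differentiableAt (by simp)
  obtain rfl : ψ = fun y => iM (φ y) := funext hψ
  simp only [pdu, pdv, fderiv_iM_comp hd (hQ x hx), B_iMDeriv (hQ x hx), and_self]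
end
end

section
/- Let a, b, c ∈ ℝ and r > 0, and define f(v) = −a² − b² + c² + r² + 4cr·cos(v) + 2r²·cos(v)². If a² + b² + c² < r², or |c| < −2r + √(a²+b²+r²), or |c| > 2r + √(a²+b²+r²), then f(v) ≠ 0 for all v ∈ ℝ. -/
noncomputable section

theorem stmt_15 (a b c r : ℝ) (hr : 0 < r)
    (h : a ^ 2 + b ^ 2 + c ^ 2 < r ^ 2 ∨
         |c| < -2 * r + Real.sqrt (a ^ 2 + b ^ 2 + r ^ 2) ∨
         |c| > 2 * r + Real.sqrt (a ^ 2 + b ^ 2 + r ^ 2)) :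
    ∀ v : ℝ,
      -a ^ 2 - b ^ 2 + c ^ 2 + r ^ 2 + 4 * c * r * Real.cos v +
        2 * r ^ 2 * Real.cos v ^ 2 ≠ 0 := by
  intro v
  have hx : |Real.cos v| ≤ 1 := Real.abs_cos_le_one v
  have hx0 : 0 ≤ |Real.cos v| := abs_nonneg _
  have hc0 : 0 ≤ |c| := abs_nonneg c
  have hcx := abs_le.mp (abs_mul c (Real.cos v)).le
  rw [← sq_abs (Real.cos v)]
  generalize Real.cos v = x at *
  generalize |x| = y at *
  have hs0 : 0 ≤ Real.sqrt (a ^ 2 + b ^ 2 + r ^ 2) := Real.sqrt_nonneg _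
  have hs : Real.sqrt (a ^ 2 + b ^ 2 + r ^ 2) ^ 2 = a ^ 2 + b ^ 2 + r ^ 2 :=
    Real.sq_sqrt (by positivity)
  generalize Real.sqrt (a ^ 2 + b ^ 2 + r ^ 2) = s at *
  have hc : |c| ^ 2 = c ^ 2 := sq_abs c
  generalize |c| = d at *
  have hlow : r * -(d * y) ≤ r * (c * x) := mul_le_mul_of_nonneg_left hcx.1 hr.le
  have hupp : r * (c * x) ≤ r * (d * y) := mul_le_mul_of_nonneg_left hcx.2 hr.le
  rcases h with h | h | h
  · apply ne_of_gt
    nlinarith [sq_nonneg (r * y - d)]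
  · apply ne_of_lt
    have hsq : (d + 2 * r) ^ 2 < s ^ 2 :=
      pow_lt_pow_left₀ (by linarith) (by positivity) two_ne_zero
    have hdy : r * (d * y) ≤ r * d :=
      mul_le_mul_of_nonneg_left (mul_le_of_le_one_right hc0 hx) hr.le
    have hry : r ^ 2 * y ^ 2 ≤ r ^ 2 :=
      mul_le_of_le_one_right (sq_nonneg r) (pow_le_one₀ hx0 hx)
    nlinarith [sq_pos_of_pos hr]
  · apply ne_of_gt
    have hsq : s ^ 2 < (d - 2 * r) ^ 2 :=
      pow_lt_pow_left₀ (by linarith) hs0 two_ne_zero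
    have hry : r * y ≤ r := mul_le_of_le_one_right hr.le hx
    have hmono : 0 ≤ r * ((1 - y) * (2 * d - r - r * y)) :=
      mul_nonneg hr.le (mul_nonneg (by linarith) (by linarith))
    nlinarith
end
end

section
/- Let a, b, c ∈ ℝ and r > 0. If |c| > 2r + √(a² + b² + r²), then for all v ∈ [0, π] one has −a² − b² + c² + 4cr·cos(v)³ + 3r²·cos(2v) − 4r·√(a²+b²)·sin(v)³ > 0. -/
noncomputable section

theorem stmt_16 (a b c r : ℝ) (hr : 0 < r)
    (h : |c| > 2 * r + Real.sqrt (a ^ 2 + b ^ 2 + r ^ 2)) :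
    ∀ v ∈ Set.Icc (0 : ℝ) Real.pi,
      -a ^ 2 - b ^ 2 + c ^ 2 + 4 * c * r * Real.cos v ^ 3 +
        3 * r ^ 2 * Real.cos (2 * v) -
        4 * r * Real.sqrt (a ^ 2 + b ^ 2) * Real.sin v ^ 3 > 0 := by
  intro v hv
  have hs0 : 0 ≤ Real.sin v := Real.sin_nonneg_of_mem_Icc hv
  have hs1 : Real.sin v ≤ 1 := Real.sin_le_one v
  have hx1 : |Real.cos v| ≤ 1 := Real.abs_cos_le_one v
  have hx0 : 0 ≤ |Real.cos v| := abs_nonneg _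
  have hx2 : |Real.cos v| ^ 2 = Real.cos v ^ 2 := sq_abs _
  have hsc : Real.sin v ^ 2 + |Real.cos v| ^ 2 = 1 := by
    rw [hx2, Real.sin_sq_add_cos_sq]
  have hcx : -(|c| * |Real.cos v| ^ 3) ≤ c * Real.cos v ^ 3 := by
    rw [← abs_pow, ← abs_mul]
    exact neg_abs_le _
  have hRD : √(a ^ 2 + b ^ 2) ≤ √(a ^ 2 + b ^ 2 + r ^ 2) :=
    Real.sqrt_le_sqrt (by nlinarith)
  have hR0 : 0 ≤ √(a ^ 2 + b ^ 2) := Real.sqrt_nonneg _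
  have hD2 : √(a ^ 2 + b ^ 2 + r ^ 2) ^ 2 = a ^ 2 + b ^ 2 + r ^ 2 :=
    Real.sq_sqrt (by positivity)
  rw [Real.cos_two_mul, ← hx2]
  rw [← sq_abs c]
  generalize √(a ^ 2 + b ^ 2) = R at *
  generalize √(a ^ 2 + b ^ 2 + r ^ 2) = D at *
  generalize |Real.cos v| = x at *
  generalize Real.sin v = s at *
  have hx3 : x ^ 3 ≤ x ^ 2 := pow_le_pow_of_le_one hx0 hx1 (by norm_num)
  have hs3 : s ^ 3 ≤ s ^ 2 := pow_le_pow_of_le_one hs0 hs1 (by norm_num)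
  have hx3' : x ^ 3 ≤ 1 := pow_le_one₀ hx0 hx1
  have hC : 0 < (|c| - (2 * r + D)) * (|c| + (2 * r + D) - 4 * r * x ^ 3) := by
    apply mul_pos (by linarith)
    nlinarith [mul_le_mul_of_nonneg_left hx3' hr.le]
  have hDR : R * s ^ 3 ≤ D * (1 - x ^ 3) :=
    mul_le_mul hRD (by linarith) (by positivity) (by linarith)
  have hpoly : 0 ≤ r ^ 2 * (2 + 6 * x ^ 2 - 8 * x ^ 3) :=
    mul_nonneg (by positivity) (by linarith)
  linarith [mul_le_mul_of_nonneg_left hDR hr.le, mul_le_mul_of_nonneg_left hcx hr.le]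
end
end

section
/- Let a, b, c ∈ ℝ and r > 0. If √(a² + b²) > 2r + √(c² + r²), then for all v ∈ [0, π] one has −a² − b² + c² + 4cr·cos(v)³ + 3r²·cos(2v) + 4r·√(a²+b²)·sin(v)³ < 0. -/
noncomputable section

theorem stmt_17 (a b c r : ℝ) (hr : 0 < r)
    (h : Real.sqrt (a ^ 2 + b ^ 2) > 2 * r + Real.sqrt (c ^ 2 + r ^ 2)) :
    ∀ v ∈ Set.Icc (0 : ℝ) Real.pi,
      -a ^ 2 - b ^ 2 + c ^ 2 + 4 * c * r * Real.cos v ^ 3 +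
        3 * r ^ 2 * Real.cos (2 * v) +
        4 * r * Real.sqrt (a ^ 2 + b ^ 2) * Real.sin v ^ 3 < 0 := by
  intro v hv
  have hs0 : 0 ≤ Real.sin v := Real.sin_nonneg_of_mem_Icc hv
  have hs1 : Real.sin v ≤ 1 := Real.sin_le_one v
  have hx : |Real.cos v| ≤ 1 := Real.abs_cos_le_one v
  have hsx : Real.sin v ^ 2 + Real.cos v ^ 2 = 1 := Real.sin_sq_add_cos_sq v
  have hR : Real.sqrt (a ^ 2 + b ^ 2) ^ 2 = a ^ 2 + b ^ 2 := Real.sq_sqrt (by positivity)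
  have hS : Real.sqrt (c ^ 2 + r ^ 2) ^ 2 = c ^ 2 + r ^ 2 := Real.sq_sqrt (by positivity)
  have hcS : |c| ≤ Real.sqrt (c ^ 2 + r ^ 2) := Real.abs_le_sqrt (by nlinarith)
  have hS0 : 0 ≤ Real.sqrt (c ^ 2 + r ^ 2) := Real.sqrt_nonneg _
  rw [Real.cos_two_mul]
  generalize Real.sqrt (a ^ 2 + b ^ 2) = R at *
  generalize Real.sqrt (c ^ 2 + r ^ 2) = S at *
  generalize Real.sin v = s at *
  generalize Real.cos v = x at *
  have hs3 : s ^ 3 ≤ s ^ 2 := pow_le_pow_of_le_one hs0 hs1 (by norm_num)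
  have hs3' : s ^ 3 ≤ 1 := pow_le_one₀ hs0 hs1
  have hx3 : |x| ^ 3 ≤ 1 - s ^ 3 := by
    have := pow_le_pow_of_le_one (abs_nonneg x) hx (show 2 ≤ 3 by norm_num)
    rw [sq_abs] at this
    linarith
  have hcx : c * x ^ 3 ≤ S * (1 - s ^ 3) := calc
    c * x ^ 3 ≤ |c| * |x| ^ 3 := by rw [← abs_pow, ← abs_mul]; exact le_abs_self _
    _ ≤ S * (1 - s ^ 3) := mul_le_mul hcS hx3 (by positivity) hS0
  have hmono : 0 < (R - (2 * r + S)) * (R + (2 * r + S) - 4 * r * s ^ 3) :=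
    mul_pos (by linarith) (by nlinarith)
  have hpoly : 0 ≤ r ^ 2 * (2 + 6 * s ^ 2 - 8 * s ^ 3) :=
    mul_nonneg (by positivity) (by linarith)
  have hrcx := mul_le_mul_of_nonneg_left hcx hr.le
  have hx2 : x ^ 2 = 1 - s ^ 2 := by linarith
  rw [hx2]
  linarith
end
end
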